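/- arXiv:2407.08444 — 6 statements merged into one kernel-verified Lean document; each statement's English description precedes it below -/
import Mathlib

section
/- Let α, β, γ be real numbers with αβ > 0, let g : [0,1) → ℝ be continuous and nonnegative, and let w : [0,1) → ℝ be continuously differentiable on [0,1), twice differentiable on (0,1), and satisfy the inhomogeneous hypergeometric equation z(1−z)w''(z) + (γ − (α+β+1)z)w'(z) − αβ w(z) = g(z) for all z ∈ (0,1). If w(0) ≥ 0 and w'(0) > 0, then w is strictly increasing on [0,1). -/
open Real

/-- A function positive to the left of a zero has nonpositive derivative there. -/
theorem HasDerivAt.nonpos_of_pos_left_of_eq_zero {f : ℝ → ℝ} {a x f' : ℝ} (hax : a < x)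
    (hf : HasDerivAt f f' x) (hx : f x = 0) (hpos : ∀ y ∈ Set.Ioo a x, 0 < f y) : f' ≤ 0 := by
  have hslope := (hasDerivAt_iff_tendsto_slope_left_right.1 hf).1
  refine le_of_tendsto hslope ?_
  filter_upwards [Ioo_mem_nhdsLT hax] with y hy
  rw [slope_def_field, hx, sub_zero]
  exact (div_neg_of_pos_of_neg (hpos y hy) (sub_neg.2 hy.2)).le

/-- Monotonicity for the inhomogeneous hypergeometric equation: if `αβ > 0`, `g ≥ 0`
is continuous on `[0,1)`, and `w ∈ C¹([0,1)) ∩ C²((0,1))` solves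
`z(1-z)w'' + (γ-(α+β+1)z)w' - αβ w = g` on `(0,1)` with `w(0) ≥ 0` and `w'(0) > 0`,
then `w` is strictly increasing on `[0,1)`. -/
theorem hypergeometric_inhomogeneous_strict_mono
    (α β γ : ℝ) (hαβ : 0 < α * β)
    (g w w' w'' : ℝ → ℝ)
    (hg_cont : ContinuousOn g (Set.Ico 0 1))
    (hg_nonneg : ∀ z ∈ Set.Ico (0 : ℝ) 1, 0 ≤ g z)
    (hw' : ∀ z ∈ Set.Ico (0 : ℝ) 1, HasDerivWithinAt w (w' z) (Set.Ico 0 1) z)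
    (hw'_cont : ContinuousOn w' (Set.Ico 0 1))
    (hw'' : ∀ z ∈ Set.Ioo (0 : ℝ) 1, HasDerivAt w' (w'' z) z)
    (hode : ∀ z ∈ Set.Ioo (0 : ℝ) 1,
      z * (1 - z) * w'' z + (γ - (α + β + 1) * z) * w' z - α * β * w z = g z)
    (hw0 : 0 ≤ w 0) (hw'0 : 0 < w' 0) :
    StrictMonoOn w (Set.Ico 0 1) := by
  have hw_cont : ContinuousOn w (Set.Ico 0 1) := fun z hz => (hw' z hz).continuousWithinAt
  have mono_of_pos : ∀ s ⊆ Set.Ico (0 : ℝ) 1, Convex ℝ s →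
      (∀ z ∈ interior s, 0 < w' z) → StrictMonoOn w s := by
    intro s hs hconv hpos
    refine strictMonoOn_of_hasDerivWithinAt_pos hconv (hw_cont.mono hs)
      (fun z hz => (hw' z (hs (interior_subset hz))).mono (interior_subset.trans hs)) hpos
  refine mono_of_pos _ subset_rfl (convex_Ico 0 1) fun z₁ hz₁ => ?_
  replace hz₁ := interior_subset hz₁
  by_contra! hneg
  have hsub : Set.Icc 0 z₁ ⊆ Set.Ico (0 : ℝ) 1 := fun z hz => ⟨hz.1, hz.2.trans_lt hz₁.2⟩
  have hcompact : IsCompact (Set.Icc 0 z₁ ∩ w' ⁻¹' Set.Iic 0) :=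
    isCompact_Icc.of_isClosed_subset
      ((hw'_cont.mono hsub).preimage_isClosed_of_isClosed isClosed_Icc isClosed_Iic)
      Set.inter_subset_left
  obtain ⟨z₀, ⟨hz₀, hz₀_nonpos⟩, hleast⟩ :=
    hcompact.exists_isLeast ⟨z₁, ⟨hz₁.1, le_rfl⟩, hneg⟩
  simp only [Set.mem_preimage, Set.mem_Iic] at hz₀_nonpos
  have hz₀_pos : 0 < z₀ := by
    refine hz₀.1.lt_of_ne fun h => ?_
    rw [← h] at hz₀_nonpos
    exact hz₀_nonpos.not_gt hw'0
  have hz₀_lt : z₀ < 1 := (hsub hz₀).2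
  have hpos : ∀ z ∈ Set.Ioo 0 z₀, 0 < w' z := by
    intro z hz
    by_contra! h
    exact (hleast ⟨⟨hz.1.le, hz.2.le.trans hz₀.2⟩, h⟩).not_gt hz.2
  have hderiv := hw'' z₀ ⟨hz₀_pos, hz₀_lt⟩
  have hzero : w' z₀ = 0 := by
    refine le_antisymm hz₀_nonpos
      (ge_of_tendsto (hderiv.continuousAt.tendsto.mono_left (nhdsWithin_le_nhds (s := Set.Iio z₀))) ?_)
    filter_upwards [Ioo_mem_nhdsLT hz₀_pos] with z hz using (hpos z hz).le
  have hw_lt : w 0 < w z₀ :=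
    mono_of_pos (Set.Icc 0 z₀) ((Set.Icc_subset_Icc_right hz₀.2).trans hsub) (convex_Icc 0 z₀)
      (by simpa only [interior_Icc] using hpos)
      (Set.left_mem_Icc.2 hz₀_pos.le) (Set.right_mem_Icc.2 hz₀_pos.le) hz₀_pos
  have hw''_nonpos := hderiv.nonpos_of_pos_left_of_eq_zero hz₀_pos hzero hpos
  have hode₀ := hode z₀ ⟨hz₀_pos, hz₀_lt⟩
  have hg₀ := hg_nonneg z₀ ⟨hz₀_pos.le, hz₀_lt⟩
  have hαβw : 0 < α * β * w z₀ := mul_pos hαβ (hw0.trans_lt hw_lt)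
  have hlead : z₀ * (1 - z₀) * w'' z₀ ≤ 0 :=
    mul_nonpos_of_nonneg_of_nonpos (mul_pos hz₀_pos (sub_pos.2 hz₀_lt)).le hw''_nonpos
  rw [hzero, mul_zero] at hode₀
  linarith
end

section
/- Let α, β, γ be real numbers with γ > 0 and αβ > 0, and with γ not a nonpositive integer. Then the function z ↦ F(α,β;γ;z) − 1, where F(α,β;γ;z) = ∑_{n=0}^∞ ((α)_n (β)_n)/((γ)_n · n!) · z^n, is strictly increasing on the interval [0,1). -/
open Real

/-- The Gauss hypergeometric function `F(α,β;γ;z) = ∑ (α)_n(β)_n/((γ)_n n!) zⁿ`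
as a function of a real variable `z`. -/
noncomputable def hypF (α β γ z : ℝ) : ℝ :=
  ∑' n : ℕ, ((ascPochhammer ℝ n).eval α * (ascPochhammer ℝ n).eval β /
    ((ascPochhammer ℝ n).eval γ * (n.factorial : ℝ))) * z ^ n

open Filter Topology in
/-- A function that is positive at `0` and whose derivative is positive at each of its zeros
preceded only by positive values is positive on `[0,1)`. -/
theorem pos_of_deriv_pos_at_first_zero {f f' : ℝ → ℝ} (hf0 : 0 < f 0)
    (hf : ∀ z ∈ Set.Ico (0 : ℝ) 1, HasDerivAt f (f' z) z)
    (h : ∀ z ∈ Set.Ioo (0 : ℝ) 1, (∀ y ∈ Set.Ico 0 z, 0 < f y) → f z = 0 → 0 < f' z) :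
    ∀ z ∈ Set.Ico (0 : ℝ) 1, 0 < f z := by
  intro z hz
  by_contra! hneg
  have hcont : ContinuousOn f (Set.Icc 0 z) := fun x hx =>
    (hf x ⟨hx.1, hx.2.trans_lt hz.2⟩).continuousAt.continuousWithinAt
  have hclosed : IsClosed (Set.Icc 0 z ∩ f ⁻¹' Set.Iic 0) :=
    hcont.preimage_isClosed_of_isClosed isClosed_Icc isClosed_Iic
  obtain ⟨x, ⟨⟨hx0, hxz⟩, hfx⟩, hmin⟩ :=
    (isCompact_Icc.of_isClosed_subset hclosed Set.inter_subset_left).exists_isLeast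
      ⟨z, ⟨hz.1, le_rfl⟩, hneg⟩
  simp only [Set.mem_preimage, Set.mem_Iic] at hfx
  have hx1 : x < 1 := hxz.trans_lt hz.2
  have hxpos : 0 < x := by
    rcases hx0.eq_or_lt with h0 | h0
    · rw [← h0] at hfx
      exact absurd hf0 hfx.not_gt
    · exact h0
  have hpos : ∀ y ∈ Set.Ico 0 x, 0 < f y := by
    intro y hy
    by_contra! hle
    exact (hmin ⟨⟨hy.1, hy.2.le.trans hxz⟩, hle⟩).not_gt hy.2
  have hev : ∀ᶠ y in 𝓝[<] x, 0 < f y :=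
    (Ioo_mem_nhdsLT hxpos : Set.Ioo 0 x ∈ 𝓝[<] x) |> mem_of_superset <|
      fun y hy => hpos y ⟨hy.1.le, hy.2⟩
  have hxd := hf x ⟨hx0, hx1⟩
  have hzero : f x = 0 := le_antisymm hfx <|
    ge_of_tendsto (hxd.continuousAt.tendsto.mono_left nhdsWithin_le_nhds)
      (hev.mono fun _ hy => hy.le)
  have hd := h x ⟨hxpos, hx1⟩ hpos hzero
  have hsign := eventually_nhdsWithin_sign_eq_of_deriv_pos (hxd.deriv.symm ▸ hd) hzero
  obtain ⟨y, hy, hys, hyx⟩ :=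
    (hev.and ((hsign.filter_mono nhdsWithin_le_nhds).and self_mem_nhdsWithin)).exists
  rw [sign_pos hy, sign_neg (sub_neg.2 hyx)] at hys
  exact absurd hys (by decide)

/-- If `∑ aₙ rⁿ` converges on `(-1,1)`, then so does its termwise derivative. -/
theorem summable_deriv_coeff_mul_pow {a : ℕ → ℝ}
    (ha : ∀ r : ℝ, |r| < 1 → Summable fun n => a n * r ^ n) {r : ℝ} (hr : |r| < 1) :
    Summable fun n : ℕ => (n + 1) * a (n + 1) * r ^ n := by
  obtain ⟨s, hrs, hs1⟩ := exists_between hr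
  have hs0 : 0 < s := (abs_nonneg r).trans_lt hrs
  have hsum := (ha s (by rwa [abs_of_pos hs0])).abs
  have hq : ‖|r| / s‖ < 1 := by
    rw [Real.norm_of_nonneg (by positivity)]
    exact (div_lt_one hs0).2 hrs
  have hg : Summable fun n : ℕ => ((n : ℝ) ^ 1 * (|r| / s) ^ n + (|r| / s) ^ n) *
      ((∑' n, |a n * s ^ n|) / s) :=
    ((summable_pow_mul_geometric_of_norm_lt_one 1 hq).add
      (summable_geometric_of_norm_lt_one hq)).mul_right _
  refine hg.of_norm_bounded fun n => ?_
  have hle := hsum.le_tsum (n + 1) fun _ _ => abs_nonneg _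
  have heq : ‖(n + 1) * a (n + 1) * r ^ n‖ =
      ((n : ℝ) ^ 1 * (|r| / s) ^ n + (|r| / s) ^ n) * (|a (n + 1) * s ^ (n + 1)| / s) := by
    rw [Real.norm_eq_abs, abs_mul, abs_mul, abs_mul, abs_pow, abs_pow, abs_of_pos hs0,
      abs_of_nonneg (by positivity : (0 : ℝ) ≤ n + 1)]
    rw [div_pow]
    field_simp
    ring
  rw [heq]
  gcongr

/-- Termwise differentiation of a real power series converging on `(-1,1)`. -/
theorem hasDerivAt_tsum_mul_pow {a : ℕ → ℝ}
    (ha : ∀ r : ℝ, |r| < 1 → Summable fun n => a n * r ^ n) {z : ℝ} (hz : |z| < 1) :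
    HasDerivAt (fun x => ∑' n, a n * x ^ n) (∑' n : ℕ, (n + 1) * a (n + 1) * z ^ n) z := by
  obtain ⟨s, hzs, hs1⟩ := exists_between hz
  have hs0 : 0 < s := (abs_nonneg z).trans_lt hzs
  have hsabs : |s| < 1 := by rwa [abs_of_pos hs0]
  have hu : Summable fun n : ℕ => |a n * (n * s ^ (n - 1))| := by
    rw [← summable_nat_add_iff 1]
    refine (summable_deriv_coeff_mul_pow ha hsabs).abs.congr fun n => ?_
    push_cast [Nat.add_sub_cancel]
    ring_nf
  have hbound : ∀ (n : ℕ), ∀ y ∈ Set.Ioo (-s) s,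
      ‖a n * (n * y ^ (n - 1))‖ ≤ |a n * (n * s ^ (n - 1))| := by
    intro n y hy
    have hys : |y| ≤ |s| := (abs_lt.2 hy).le.trans (le_abs_self s)
    simp only [Real.norm_eq_abs, abs_mul, abs_pow]
    gcongr
  have hzmem : z ∈ Set.Ioo (-s) s := abs_lt.1 hzs
  have hder := hasDerivAt_tsum_of_isPreconnected hu isOpen_Ioo isPreconnected_Ioo
    (fun n y _ => (hasDerivAt_pow n y).const_mul (a n)) hbound hzmem (ha z hz) hzmem
  have hs : Summable fun n : ℕ => a n * (n * z ^ (n - 1)) :=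
    hu.of_norm_bounded fun n => hbound n z hzmem
  have heq : ∑' n : ℕ, a n * (n * z ^ (n - 1)) = ∑' n : ℕ, (n + 1) * a (n + 1) * z ^ n := by
    rw [hs.tsum_eq_zero_add]
    simp only [Nat.cast_zero, zero_mul, mul_zero, zero_add]
    refine tsum_congr fun n => ?_
    push_cast [Nat.add_sub_cancel]
    ring
  exact heq ▸ hder

/-- Multiplying a termwise derivative by `z` gives the series with coefficients `n aₙ`. -/
theorem hasSum_nat_mul_coeff {a : ℕ → ℝ} {z s : ℝ}
    (h : HasSum (fun n : ℕ => (n + 1) * a (n + 1) * z ^ n) s) :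
    HasSum (fun n : ℕ => n * a n * z ^ n) (z * s) := by
  rw [← hasSum_nat_add_iff' 1]
  simp only [Finset.range_one, Finset.sum_singleton, Nat.cast_zero, zero_mul, sub_zero]
  exact (h.mul_left z).congr_fun fun n => by push_cast; ring

open Filter Topology in
/-- A sequence satisfying the hypergeometric recurrence generates a power series that converges
on `(-1,1)`. -/
theorem summable_of_hypergeometric_recurrence {α β γ : ℝ} {c : ℕ → ℝ} (hγ : 0 < γ)
    (hc : ∀ n : ℕ, (n + 1) * (γ + n) * c (n + 1) = (α + n) * (β + n) * c n)
    {r : ℝ} (hr : |r| < 1) : Summable fun n => c n * r ^ n := by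
  obtain ⟨s, hrs, hs1⟩ := exists_between hr
  have hlim : Tendsto (fun n : ℕ => |(α + n) / (1 + n) * ((β + n) / (γ + n)) * r|) atTop
      (𝓝 |r|) := by
    have h₁ := tendsto_add_mul_div_add_mul_atTop_nhds α 1 (1 : ℝ) one_ne_zero
    have h₂ := tendsto_add_mul_div_add_mul_atTop_nhds β γ (1 : ℝ) one_ne_zero
    simpa using ((h₁.mul h₂).mul_const r).abs
  refine summable_of_ratio_norm_eventually_le hs1 ?_
  filter_upwards [hlim.eventually_lt_const hrs] with n hn
  have hγn : 0 < γ + n := by positivity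
  have hn1 : (0 : ℝ) < 1 + n := by positivity
  have heq : c (n + 1) * r ^ (n + 1) =
      (α + n) / (1 + n) * ((β + n) / (γ + n)) * r * (c n * r ^ n) := by
    have hcn : c (n + 1) = (α + n) * (β + n) * c n / ((1 + n) * (γ + n)) := by
      rw [eq_div_iff (by positivity), ← hc n]
      ring
    rw [hcn, pow_succ]
    field_simp
  rw [heq, norm_mul, Real.norm_eq_abs]
  gcongr

/-- The power series of a sequence satisfying the hypergeometric recurrence solves the
hypergeometric differential equation. -/
theorem hypergeometric_ode_of_recurrence {α β γ z w w₁ w₂ : ℝ} {c : ℕ → ℝ}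
    (hc : ∀ n : ℕ, (n + 1) * (γ + n) * c (n + 1) = (α + n) * (β + n) * c n)
    (hw : HasSum (fun n => c n * z ^ n) w)
    (hw₁ : HasSum (fun n : ℕ => (n + 1) * c (n + 1) * z ^ n) w₁)
    (hw₂ : HasSum (fun n : ℕ => (n + 1) * (((n + 1 : ℕ) + 1) * c (n + 1 + 1)) * z ^ n) w₂) :
    z * (1 - z) * w₂ + (γ - (α + β + 1) * z) * w₁ - α * β * w = 0 := by
  have h₁ := hasSum_nat_mul_coeff hw₁
  have h₂ := hasSum_nat_mul_coeff (a := fun n : ℕ => (n + 1) * c (n + 1)) hw₂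
  have h₃ : HasSum (fun n : ℕ => (n - 1) * (n * c n) * z ^ n) (z * (z * w₂)) := by
    rw [← hasSum_nat_add_iff' 1]
    simp only [Finset.range_one, Finset.sum_singleton, Nat.cast_zero, zero_mul, mul_zero,
      sub_zero]
    exact (h₂.mul_left z).congr_fun fun n => by push_cast; ring
  have htotal := (((h₂.sub h₃).add (hw₁.mul_left γ)).sub (h₁.mul_left (α + β + 1))).sub
    (hw.mul_left (α * β))
  have hzero := htotal.unique (hasSum_zero.congr_fun fun n => by
    linear_combination z ^ n * hc n)
  linear_combination hzero

/-- The coefficients of the hypergeometric series satisfy the hypergeometric recurrence. -/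
theorem hypergeometric_coeff_recurrence {α β γ : ℝ} (hγ : 0 < γ) (n : ℕ) :
    (n + 1) * (γ + n) * ((ascPochhammer ℝ (n + 1)).eval α * (ascPochhammer ℝ (n + 1)).eval β /
      ((ascPochhammer ℝ (n + 1)).eval γ * ((n + 1).factorial : ℝ))) =
    (α + n) * (β + n) * ((ascPochhammer ℝ n).eval α * (ascPochhammer ℝ n).eval β /
      ((ascPochhammer ℝ n).eval γ * (n.factorial : ℝ))) := by
  have hp := ascPochhammer_pos n γ hγ
  have hγn : 0 < γ + n := by positivity
  simp only [ascPochhammer_succ_eval, Nat.factorial_succ]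
  push_cast
  field_simp

/-- If `γ > 0` and `αβ > 0` (and `γ` is not a nonpositive integer), then
`z ↦ F(α,β;γ;z) - 1` is strictly increasing on `[0,1)`. -/
theorem hypergeometric_sub_one_strictMono (α β γ : ℝ)
    (hγpos : 0 < γ) (hαβ : 0 < α * β) (hγ : ∀ n : ℕ, γ ≠ -(n : ℝ)) :
    StrictMonoOn (fun z => hypF α β γ z - 1) (Set.Ico (0 : ℝ) 1) := by
  set c : ℕ → ℝ := fun n => (ascPochhammer ℝ n).eval α * (ascPochhammer ℝ n).eval β /
    ((ascPochhammer ℝ n).eval γ * (n.factorial : ℝ)) with hc_def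
  have hc : ∀ n : ℕ, (n + 1) * (γ + n) * c (n + 1) = (α + n) * (β + n) * c n :=
    hypergeometric_coeff_recurrence hγpos
  have hc0 : c 0 = 1 := by simp [hc_def]
  have hc1 : 0 < c 1 := by
    have h0 := hc 0
    simp only [Nat.cast_zero, zero_add, add_zero, one_mul, hc0, mul_one] at h0
    exact pos_of_mul_pos_right (h0 ▸ hαβ) hγpos.le
  have hS : ∀ r : ℝ, |r| < 1 → Summable fun n => c n * r ^ n := fun r hr =>
    summable_of_hypergeometric_recurrence hγpos hc hr
  have hS₁ : ∀ r : ℝ, |r| < 1 → Summable fun n : ℕ => (n + 1) * c (n + 1) * r ^ n :=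
    fun r hr => summable_deriv_coeff_mul_pow hS hr
  have habs : ∀ z ∈ Set.Ico (0 : ℝ) 1, |z| < 1 := fun z hz => by
    rw [abs_of_nonneg hz.1]
    exact hz.2
  set w₁ : ℝ → ℝ := fun z => ∑' n : ℕ, (n + 1) * c (n + 1) * z ^ n with hw₁_def
  have hd : ∀ z ∈ Set.Ico (0 : ℝ) 1, HasDerivAt (hypF α β γ) (w₁ z) z := fun z hz =>
    hasDerivAt_tsum_mul_pow hS (habs z hz)
  have hF0 : hypF α β γ 0 = 1 := by
    change ∑' n, c n * 0 ^ n = 1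
    rw [tsum_eq_single 0 fun n hn => by simp [hn]]
    simp [hc0]
  have hw₁0 : 0 < w₁ 0 := by
    have : w₁ 0 = c 1 := by
      rw [hw₁_def]
      dsimp only
      rw [tsum_eq_single 0 fun n hn => by simp [hn]]
      simp
    rwa [this]
  have hmono : ∀ D : Set ℝ, Convex ℝ D → D ⊆ Set.Ico 0 1 → (∀ y ∈ interior D, 0 < w₁ y) →
      StrictMonoOn (hypF α β γ) D := fun D hD hsub hpos =>
    strictMonoOn_of_deriv_pos hD
      (fun y hy => (hd y (hsub hy)).continuousAt.continuousWithinAt)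
      fun y hy => (hd y (hsub (interior_subset hy))).deriv.symm ▸ hpos y hy
  have hpos := pos_of_deriv_pos_at_first_zero hw₁0
    (fun z hz => hasDerivAt_tsum_mul_pow hS₁ (habs z hz)) fun z hz hbefore hzero => by
      have hz' : z ∈ Set.Ico (0 : ℝ) 1 := ⟨hz.1.le, hz.2⟩
      have hz₁ := habs z hz'
      have hode := hypergeometric_ode_of_recurrence hc (hS z hz₁).hasSum (hS₁ z hz₁).hasSum
        (summable_deriv_coeff_mul_pow hS₁ hz₁).hasSum
      have hF : 1 < hypF α β γ z := hF0 ▸ hmono (Set.Icc 0 z) (convex_Icc 0 z)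
        (fun y hy => ⟨hy.1, hy.2.trans_lt hz.2⟩)
        (fun y hy => hbefore y (by rw [interior_Icc] at hy; exact ⟨hy.1.le, hy.2⟩))
        (Set.left_mem_Icc.2 hz.1.le) (Set.right_mem_Icc.2 hz.1.le) hz.1
      have hαβF : 0 < α * β * hypF α β γ z := mul_pos hαβ (one_pos.trans hF)
      change _ + _ * w₁ z - α * β * hypF α β γ z = 0 at hode
      rw [hzero, mul_zero, add_zero, sub_eq_zero] at hode
      exact pos_of_mul_pos_right (hode ▸ hαβF) (mul_nonneg hz.1.le (sub_nonneg.2 hz.2.le))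
  intro x hx y hy hxy
  exact sub_lt_sub_right (hmono _ (convex_Ico 0 1) subset_rfl
    (fun y hy => hpos y (interior_subset hy)) hx hy hxy) 1
end

section
/- Let ν > 3 be real, let W(R) = (1 + R²/15)^{−3/2} for R ≥ 0, and let V₁ : (0,∞) → ℝ be the explicit function V₁(R) = √15(ν+1)·[ −360(R²−15)R⁵ − 50400 ν (R²−15) R³ log((R²+15)/15) − 75ν(13R⁶ − 1397R⁴ + 6195R² + 4725)R + 7√15 ν (R⁸ + 300R⁶ − 20250R⁴ + 67500R² + 50625) arctan(R/√15) ] / (64 R³ (R²+15)^{5/2}). Then there exists t₀ ∈ (0,1] such that for all t ∈ (0,t₀] and all R > 0 one has W(R) + t^{2ν} V₁(R) > 0. (Equivalently, with λ(t) = t^{−1−ν}, the approximate solution u₀ + v₁ = λ^{3/2}·(W(λr) + (tλ)^{−2}V₁(λr)) is strictly positive on [0,∞) × (0,t₀].) -/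
open Real

/-- The explicit first correction profile `V₁(R)` in dimension `d = 5`. -/
noncomputable def V₁ (ν R : ℝ) : ℝ :=
  Real.sqrt 15 * (ν + 1) *
    (-360 * (R ^ 2 - 15) * R ^ 5
      - 50400 * ν * (R ^ 2 - 15) * R ^ 3 * Real.log ((R ^ 2 + 15) / 15)
      - 75 * ν * (13 * R ^ 6 - 1397 * R ^ 4 + 6195 * R ^ 2 + 4725) * R
      + 7 * Real.sqrt 15 * ν *
          (R ^ 8 + 300 * R ^ 6 - 20250 * R ^ 4 + 67500 * R ^ 2 + 50625) *
        Real.arctan (R / Real.sqrt 15))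
    / (64 * R ^ 3 * (R ^ 2 + 15) ^ ((5 : ℝ) / 2))

theorem arctan_le_self_of_nonneg {x : ℝ} (hx : 0 ≤ x) : arctan x ≤ x := by
  have hmono : Monotone fun y : ℝ => y - arctan y :=
    monotone_of_hasDerivAt_nonneg (fun y => (hasDerivAt_id y).sub (hasDerivAt_arctan y))
      (fun y => by
        have : 1 / (1 + y ^ 2) ≤ 1 := by
          rw [div_le_one (by positivity)]
          nlinarith [sq_nonneg y]
        simpa using this)
  have := hmono hx
  simp only [arctan_zero, sub_zero] at this
  linarith

theorem sub_cube_div_three_le_arctan {x : ℝ} (hx : 0 ≤ x) : x - x ^ 3 / 3 ≤ arctan x := by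
  have hmono : Monotone fun y : ℝ => arctan y - y + y ^ 3 / 3 :=
    monotone_of_hasDerivAt_nonneg
      (fun y => ((hasDerivAt_arctan y).sub (hasDerivAt_id y)).add ((hasDerivAt_pow 3 y).div_const 3))
      (fun y => by
        have hy : 0 < 1 + y ^ 2 := by positivity
        have : 1 / (1 + y ^ 2) - 1 + (3 : ℕ) * y ^ (3 - 1) / 3 = y ^ 4 / (1 + y ^ 2) := by
          norm_num
          field_simp
          ring
        simp only [Pi.zero_apply]
        rw [this]
        positivity)
  have := hmono hx
  simp only [arctan_zero] at this
  norm_num at this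
  linarith

theorem sub_mul_log_le (R : ℝ) :
    (R ^ 2 - 15) * log ((R ^ 2 + 15) / 15) ≤ R ^ 4 / 15 := by
  have h0 : 0 ≤ log ((R ^ 2 + 15) / 15) :=
    log_nonneg (by rw [le_div_iff₀ (by norm_num)]; nlinarith [sq_nonneg R])
  have h1 : log ((R ^ 2 + 15) / 15) ≤ R ^ 2 / 15 := by
    have := log_le_sub_one_of_pos (show 0 < (R ^ 2 + 15) / 15 by positivity)
    linarith
  nlinarith [mul_le_mul_of_nonneg_left h1 (sq_nonneg R)]

/-- The bracket in the numerator of `V₁`, with `L` standing for `log ((R² + 15) / 15)` and `a` for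
`√15 * arctan (R / √15)`. -/
theorem numerator_lower_bound {ν R L a : ℝ} (hν : 3 < ν) (hR : 0 < R)
    (hL : (R ^ 2 - 15) * L ≤ R ^ 4 / 15) (ha : a ≤ R) (ha' : R - R ^ 3 / 45 ≤ a)
    (ha2 : 1000 ≤ R → 2 ≤ a) :
    -(10 ^ 26 * ν) * R ^ 3 ≤
      -360 * (R ^ 2 - 15) * R ^ 5 - 50400 * ν * (R ^ 2 - 15) * R ^ 3 * L
        - 75 * ν * (13 * R ^ 6 - 1397 * R ^ 4 + 6195 * R ^ 2 + 4725) * R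
        + 7 * ν * (R ^ 8 + 300 * R ^ 6 - 20250 * R ^ 4 + 67500 * R ^ 2 + 50625) * a := by
  have hν0 : 0 < ν := by linarith
  have hlog : 50400 * ν * (R ^ 2 - 15) * R ^ 3 * L ≤ 3360 * ν * R ^ 7 := by
    have := mul_le_mul_of_nonneg_left hL (show 0 ≤ 50400 * ν * R ^ 3 by positivity)
    linarith
  have hR7 : 3 * R ^ 7 ≤ ν * R ^ 7 := by gcongr
  have hR5 : 0 < R ^ 5 := by positivity
  rcases le_total 1000 R with hl | hl
  · have h2 : (1000 : ℝ) ^ 2 ≤ R ^ 2 := by gcongr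
    have hP : R ^ 8 ≤ R ^ 8 + 300 * R ^ 6 - 20250 * R ^ 4 + 67500 * R ^ 2 + 50625 := by
      have h4 : 0 ≤ R ^ 4 * (R ^ 2 - 1000 ^ 2) :=
        mul_nonneg (by positivity) (by linarith)
      nlinarith [pow_pos hR 4]
    have hPa : R ^ 8 * 2 ≤
        (R ^ 8 + 300 * R ^ 6 - 20250 * R ^ 4 + 67500 * R ^ 2 + 50625) * a :=
      mul_le_mul hP (ha2 hl) (by norm_num) (le_trans (by positivity) hP)
    have hPa' := mul_le_mul_of_nonneg_left hPa (show 0 ≤ 7 * ν by positivity)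
    have h8 : 1000 * R ^ 7 ≤ R ^ 8 := by
      have := mul_le_mul_of_nonneg_right hl (show 0 ≤ R ^ 7 by positivity)
      linarith
    have h3 : R ^ 3 ≤ R ^ 7 := pow_le_pow_right₀ (by linarith) (by norm_num)
    have h1 : R ≤ R ^ 7 := le_self_pow₀ (by linarith) (by norm_num)
    have h7 : 0 < R ^ 7 := by positivity
    have hsum : 0 ≤ ν * (14 * R ^ 8 - 4455 * R ^ 7 + 104775 * R ^ 5
        - 464625 * R ^ 3 - 354375 * R) := by
      have h75 : 10 ^ 4 * R ^ 3 ≤ R ^ 7 := by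
        have : (10 : ℝ) ^ 4 ≤ R ^ 4 :=
          le_trans (by norm_num) (pow_le_pow_left₀ (by norm_num) hl 4)
        have := mul_le_mul_of_nonneg_right this (show 0 ≤ R ^ 3 by positivity)
        linarith
      have h13 : R ≤ R ^ 3 := le_self_pow₀ (by linarith) (by norm_num)
      exact mul_nonneg hν0.le (by linarith)
    have : 0 ≤ 10 ^ 26 * ν * R ^ 3 := by positivity
    linarith
  · have h2 : R ^ 2 ≤ 10 ^ 6 := by
      calc R ^ 2 ≤ 1000 ^ 2 := by gcongr
        _ = 10 ^ 6 := by norm_num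
    have h4 : R ^ 4 ≤ 10 ^ 12 := by
      calc R ^ 4 ≤ 1000 ^ 4 := by gcongr
        _ = 10 ^ 12 := by norm_num
    have h6 : R ^ 6 ≤ 10 ^ 18 := by
      calc R ^ 6 ≤ 1000 ^ 6 := by gcongr
        _ = 10 ^ 18 := by norm_num
    have h8 : R ^ 8 ≤ 10 ^ 24 := by
      calc R ^ 8 ≤ 1000 ^ 8 := by gcongr
        _ = 10 ^ 24 := by norm_num
    have p2 := pow_pos hR 2
    have p3 := pow_pos hR 3
    have p4 := pow_pos hR 4
    have p6 := pow_pos hR 6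
    have p8 := pow_pos hR 8
    have hPa : -(10 ^ 25 * (R ^ 3 / 45)) ≤
        (R ^ 8 + 300 * R ^ 6 - 20250 * R ^ 4 + 67500 * R ^ 2 + 50625) * (a - R) := by
      refine neg_le_of_abs_le ?_
      rw [abs_mul]
      refine mul_le_mul ?_ ?_ (abs_nonneg _) (by norm_num)
      · rw [abs_le]; constructor <;> linarith
      · rw [abs_le]; constructor <;> linarith
    have hPa' := mul_le_mul_of_nonneg_left hPa (show 0 ≤ 7 * ν by positivity)
    have hpoly : 0 ≤ ν * R ^ 3 * (7 * R ^ 6 - 2355 * R ^ 4 - 36975 * R ^ 2 + 7875 + 10 ^ 25) :=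
      mul_nonneg (by positivity) (by linarith)
    have : 0 ≤ ν * R ^ 3 := by positivity
    linarith

theorem V₁_lower_bound {ν R : ℝ} (hν : 3 < ν) (hR : 0 < R) :
    -(√15 * (ν + 1) * (10 ^ 26 * ν)) / (R ^ 2 + 15) ^ ((5 : ℝ) / 2) ≤ V₁ ν R := by
  have hs : 0 < √(15 : ℝ) := by positivity
  have hs2 : √(15 : ℝ) ^ 2 = 15 := sq_sqrt (by norm_num)
  have hs3 : 3 ≤ √(15 : ℝ) := le_sqrt_of_sq_le (by norm_num)
  have hx : 0 ≤ R / √15 := by positivity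
  have ha : √15 * arctan (R / √15) ≤ R := by
    calc √15 * arctan (R / √15) ≤ √15 * (R / √15) := by
          gcongr; exact arctan_le_self_of_nonneg hx
      _ = R := by field_simp
  have ha' : R - R ^ 3 / 45 ≤ √15 * arctan (R / √15) := by
    calc R - R ^ 3 / 45 = √15 * (R / √15 - (R / √15) ^ 3 / 3) := by
          rw [show R ^ 3 / 45 = R ^ 3 / (3 * √15 ^ 2) by rw [hs2]; norm_num]
          field_simp
      _ ≤ _ := by gcongr; exact sub_cube_div_three_le_arctan hx
  have ha2 : 1000 ≤ R → 2 ≤ √15 * arctan (R / √15) := fun hl => by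
    have h1 : 1 ≤ R / √15 := by
      rw [le_div_iff₀ hs]; nlinarith
    have h2 : π / 4 ≤ arctan (R / √15) := by
      rw [← arctan_one]; exact arctan_le_arctan_iff.2 h1
    nlinarith [pi_gt_three]
  have hN := numerator_lower_bound hν hR (sub_mul_log_le R) ha ha' ha2
  have hD : 0 < (R ^ 2 + 15) ^ ((5 : ℝ) / 2) := by positivity
  have hC : 0 ≤ √15 * (ν + 1) := mul_nonneg hs.le (by linarith)
  have hM : 0 ≤ √15 * (ν + 1) * (10 ^ 26 * ν) * R ^ 3 := by
    have : 0 < ν := by linarith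
    positivity
  rw [V₁, div_le_div_iff₀ hD (by positivity)]
  have := mul_le_mul_of_nonneg_left hN hC
  calc -(√15 * (ν + 1) * (10 ^ 26 * ν)) * (64 * R ^ 3 * (R ^ 2 + 15) ^ ((5 : ℝ) / 2))
      = (-(√15 * (ν + 1) * (10 ^ 26 * ν)) * R ^ 3 * 64) * (R ^ 2 + 15) ^ ((5 : ℝ) / 2) := by ring
    _ ≤ _ := by
      refine mul_le_mul_of_nonneg_right ?_ hD.le
      linarith

theorem inv_rpow_le_ground_state (R : ℝ) :
    1 / (R ^ 2 + 15) ^ ((5 : ℝ) / 2) ≤ (1 + R ^ 2 / 15) ^ (-(3 : ℝ) / 2) := by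
  have h1 : 1 ≤ 1 + R ^ 2 / 15 := by linarith [show 0 ≤ R ^ 2 / 15 by positivity]
  calc 1 / (R ^ 2 + 15) ^ ((5 : ℝ) / 2) ≤ 1 / (1 + R ^ 2 / 15) ^ ((5 : ℝ) / 2) := by
        have h2 : 1 + R ^ 2 / 15 ≤ R ^ 2 + 15 := by linarith [sq_nonneg R]
        exact one_div_le_one_div_of_le (by positivity)
          (rpow_le_rpow (by positivity) h2 (by norm_num))
    _ = (1 + R ^ 2 / 15) ^ (-((5 : ℝ) / 2)) := by
        rw [rpow_neg (by positivity), one_div]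
    _ ≤ _ := rpow_le_rpow_of_exponent_le h1 (by norm_num)

/-- For `ν > 3` there is `t₀ ∈ (0,1]` such that `W(R) + t^(2ν) V₁(R) > 0` for all
`t ∈ (0,t₀]` and `R > 0`, where `W(R) = (1 + R²/15)^(-3/2)` is the ground state
profile in dimension 5; equivalently, the approximate solution `u₀ + v₁` is
strictly positive. -/
theorem approximate_solution_positive (ν : ℝ) (hν : 3 < ν) :
    ∃ t₀ ∈ Set.Ioc (0 : ℝ) 1, ∀ t ∈ Set.Ioc (0 : ℝ) t₀, ∀ R > (0 : ℝ),
      (1 + R ^ 2 / 15) ^ (-(3 : ℝ) / 2) + t ^ (2 * ν) * V₁ ν R > 0 := by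
  set K := √15 * (ν + 1) * (10 ^ 26 * ν) with hK
  have hK0 : 0 < K := by
    have : 0 < ν := by linarith
    positivity
  refine ⟨1 / (K + 1), ⟨by positivity, ?_⟩, ?_⟩
  · rw [div_le_one (by positivity)]
    linarith
  rintro t ⟨ht0, ht⟩ R hR
  rw [le_div_iff₀ (by positivity)] at ht
  have ht1 : t ≤ 1 := by nlinarith
  have hpow : t ^ (2 * ν) ≤ t := by
    simpa using rpow_le_rpow_of_exponent_ge ht0 ht1 (show 1 ≤ 2 * ν by linarith)
  have hpow0 : 0 < t ^ (2 * ν) := by positivity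
  have hlt : t ^ (2 * ν) * K < 1 := by nlinarith
  have hD : 0 < (R ^ 2 + 15) ^ ((5 : ℝ) / 2) := by positivity
  have hV := mul_le_mul_of_nonneg_left (V₁_lower_bound hν hR) hpow0.le
  rw [← hK] at hV
  calc 0 < (1 - t ^ (2 * ν) * K) / (R ^ 2 + 15) ^ ((5 : ℝ) / 2) := div_pos (by linarith) hD
    _ = 1 / (R ^ 2 + 15) ^ ((5 : ℝ) / 2)
        + t ^ (2 * ν) * (-K / (R ^ 2 + 15) ^ ((5 : ℝ) / 2)) := by ring
    _ ≤ _ := add_le_add (inv_rpow_le_ground_state R) hV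
end

section
/- Let ν ∈ ℝ and λ(t) = t^{−1−ν} for t > 0. Define u₀(r,t) = λ(t)^{3/2}·(1 + (λ(t)r)²/15)^{−3/2} for r > 0, t > 0 (the modulated ground state in dimension d = 5 in radial coordinates). Then for all r > 0, t > 0: t²·( u₀(r,t)^{7/3} − ∂_tt u₀(r,t) + ∂_rr u₀(r,t) + (4/r)∂_r u₀(r,t) ) = λ(t)^{3/2}·E₀(λ(t)r), where E₀(R) = −45√15(ν+1)·(225(3ν+5) + (3ν+1)R⁴ − 210(ν+1)R²) / (4(R²+15)^{7/2}). In other words, the first error e₀ = u₀^p − □u₀ of the blow-up ansatz (p = 7/3, □ = ∂_tt − ∂_rr − (4/r)∂_r in radial coordinates on ℝ⁵) satisfies t²e₀(r,t) = λ^{3/2}E₀(λr). -/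
open Real

/-- The blow-up scaling `λ(t) = t^(-1-ν)`. -/
noncomputable def lam (ν t : ℝ) : ℝ := t ^ (-1 - ν)

/-- The modulated ground state `u₀(r,t) = λ(t)^(3/2) W(λ(t)r)` in dimension `d = 5`,
in radial coordinates, with `W(R) = (1 + R²/15)^(-3/2)`. -/
noncomputable def u₀ (ν r t : ℝ) : ℝ :=
  lam ν t ^ ((3 : ℝ) / 2) * (1 + (lam ν t * r) ^ 2 / 15) ^ (-(3 : ℝ) / 2)

/-- The explicit first error profile `E₀(R)` in dimension `d = 5`. -/
noncomputable def E₀ (ν R : ℝ) : ℝ :=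
  -45 * Real.sqrt 15 * (ν + 1) *
      (225 * (3 * ν + 5) + (3 * ν + 1) * R ^ 4 - 210 * (ν + 1) * R ^ 2) /
    (4 * (R ^ 2 + 15) ^ ((7 : ℝ) / 2))

theorem lam_pos (ν : ℝ) {t : ℝ} (ht : 0 < t) : 0 < lam ν t := rpow_pos_of_pos ht _

theorem one_add_sq_div_pos (x : ℝ) : 0 < 1 + x ^ 2 / 15 := by positivity

theorem hasDerivAt_lam (ν : ℝ) {t : ℝ} (ht : 0 < t) :
    HasDerivAt (lam ν) ((-1 - ν) * lam ν t / t) t := by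
  refine (Real.hasDerivAt_rpow_const (p := -1 - ν) (Or.inl ht.ne')).congr_deriv ?_
  rw [rpow_sub_one ht.ne', lam]
  ring

/-- Powers of `λ(t)` satisfy `∂ₜ λ^a = -(1 + ν) a λ^a / t`. -/
theorem hasDerivAt_lam_rpow (ν a : ℝ) {t : ℝ} (ht : 0 < t) :
    HasDerivAt (fun s => lam ν s ^ a) ((-1 - ν) * a * lam ν t ^ a / t) t := by
  have hL := lam_pos ν ht
  convert (hasDerivAt_lam ν ht).rpow_const (p := a) (Or.inl hL.ne') using 1
  rw [rpow_sub_one hL.ne']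
  field_simp

/-- Radial derivative of powers of `1 + (lr)²/15`. -/
theorem hasDerivAt_profile_rpow_radial (l r a : ℝ) :
    HasDerivAt (fun ρ => (1 + (l * ρ) ^ 2 / 15) ^ a)
      (2 * l ^ 2 * r / 15 * a * (1 + (l * r) ^ 2 / 15) ^ (a - 1)) r := by
  have h : HasDerivAt (fun ρ => 1 + (l * ρ) ^ 2 / 15) (2 * l ^ 2 * r / 15) r := by
    refine (((((hasDerivAt_id' r).const_mul l).fun_pow 2).div_const 15).const_add 1).congr_deriv ?_
    push_cast
    ring
  exact h.rpow_const (Or.inl (one_add_sq_div_pos _).ne')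

/-- Time derivative of powers of `1 + (λ(t)r)²/15`. -/
theorem hasDerivAt_profile_rpow_time (ν r a : ℝ) {t : ℝ} (ht : 0 < t) :
    HasDerivAt (fun s => (1 + (lam ν s * r) ^ 2 / 15) ^ a)
      (2 * (-1 - ν) * (lam ν t * r) ^ 2 / (15 * t) * a *
        (1 + (lam ν t * r) ^ 2 / 15) ^ (a - 1)) t := by
  have h : HasDerivAt (fun s => 1 + (lam ν s * r) ^ 2 / 15)
      (2 * (-1 - ν) * (lam ν t * r) ^ 2 / (15 * t)) t := by
    refine (((((hasDerivAt_lam ν ht).mul_const r).fun_pow 2).div_const 15).const_add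
      1).congr_deriv ?_
    push_cast
    field_simp
  exact h.rpow_const (Or.inl (one_add_sq_div_pos _).ne')

theorem deriv_u₀_radial (ν r t : ℝ) :
    deriv (fun ρ => u₀ ν ρ t) r =
      -(lam ν t ^ ((3 : ℝ) / 2) * lam ν t ^ 2 / 5) *
        (r * (1 + (lam ν t * r) ^ 2 / 15) ^ (-(5 : ℝ) / 2)) := by
  refine (((hasDerivAt_profile_rpow_radial (lam ν t) r (-(3 : ℝ) / 2)).const_mul
    (lam ν t ^ ((3 : ℝ) / 2))).congr_deriv ?_).deriv
  rw [show -(3 : ℝ) / 2 - 1 = -(5 : ℝ) / 2 by norm_num]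
  ring

theorem deriv_deriv_u₀_radial (ν r t : ℝ) :
    deriv (fun ρ => deriv (fun ρ' => u₀ ν ρ' t) ρ) r =
      -(lam ν t ^ ((3 : ℝ) / 2) * lam ν t ^ 2 / 5) *
        ((1 + (lam ν t * r) ^ 2 / 15) ^ (-(5 : ℝ) / 2)
          - (lam ν t * r) ^ 2 / 3 * (1 + (lam ν t * r) ^ 2 / 15) ^ (-(7 : ℝ) / 2)) := by
  simp only [deriv_u₀_radial]
  refine ((((hasDerivAt_id' r).mul (hasDerivAt_profile_rpow_radial (lam ν t) r
    (-(5 : ℝ) / 2))).const_mul _).congr_deriv ?_).deriv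
  rw [show -(5 : ℝ) / 2 - 1 = -(7 : ℝ) / 2 by norm_num]
  ring

theorem deriv_u₀_time (ν r : ℝ) {t : ℝ} (ht : 0 < t) :
    deriv (fun s => u₀ ν r s) t =
      (-1 - ν) * lam ν t ^ ((3 : ℝ) / 2) / t *
        (3 / 2 * (1 + (lam ν t * r) ^ 2 / 15) ^ (-(3 : ℝ) / 2)
          - (lam ν t * r) ^ 2 / 5 * (1 + (lam ν t * r) ^ 2 / 15) ^ (-(5 : ℝ) / 2)) := by
  refine (((hasDerivAt_lam_rpow ν (3 / 2) ht).mul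
    (hasDerivAt_profile_rpow_time ν r (-(3 : ℝ) / 2) ht)).congr_deriv ?_).deriv
  rw [show -(3 : ℝ) / 2 - 1 = -(5 : ℝ) / 2 by norm_num]
  field_simp
  ring

theorem deriv_deriv_u₀_time (ν r : ℝ) {t : ℝ} (ht : 0 < t) :
    deriv (fun s => deriv (fun s' => u₀ ν r s') s) t =
      (-1 - ν) * lam ν t ^ ((3 : ℝ) / 2) / t ^ 2 *
        (((-1 - ν) * (3 / 2) - 1) *
          (3 / 2 * (1 + (lam ν t * r) ^ 2 / 15) ^ (-(3 : ℝ) / 2)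
            - (lam ν t * r) ^ 2 / 5 * (1 + (lam ν t * r) ^ 2 / 15) ^ (-(5 : ℝ) / 2))
        + (-1 - ν) * (lam ν t * r) ^ 2 *
          ((lam ν t * r) ^ 2 / 15 * (1 + (lam ν t * r) ^ 2 / 15) ^ (-(7 : ℝ) / 2)
            - 7 / 10 * (1 + (lam ν t * r) ^ 2 / 15) ^ (-(5 : ℝ) / 2))) := by
  have hev : (fun s => deriv (fun s' => u₀ ν r s') s) =ᶠ[nhds t] _ :=
    (eventually_gt_nhds ht).mono fun s hs => deriv_u₀_time ν r hs
  rw [hev.deriv_eq]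
  refine (((((hasDerivAt_lam_rpow ν (3 / 2) ht).const_mul (-1 - ν)).div
    (hasDerivAt_id' t) ht.ne').mul
      (((hasDerivAt_profile_rpow_time ν r (-(3 : ℝ) / 2) ht).const_mul (3 / 2)).sub
        (((((hasDerivAt_lam ν ht).mul_const r).fun_pow 2).div_const 5).mul
          (hasDerivAt_profile_rpow_time ν r (-(5 : ℝ) / 2) ht)))).congr_deriv ?_).deriv
  rw [show -(3 : ℝ) / 2 - 1 = -(5 : ℝ) / 2 by norm_num,
    show -(5 : ℝ) / 2 - 1 = -(7 : ℝ) / 2 by norm_num]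
  simp only [Pi.div_apply, Pi.sub_apply, Pi.mul_apply]
  push_cast
  field_simp
  ring

theorem u₀_rpow (ν r : ℝ) {t : ℝ} (ht : 0 < t) :
    u₀ ν r t ^ ((7 : ℝ) / 3) =
      lam ν t ^ ((3 : ℝ) / 2) * lam ν t ^ 2 *
        (1 + (lam ν t * r) ^ 2 / 15) ^ (-(7 : ℝ) / 2) := by
  have hL := lam_pos ν ht
  have hS := one_add_sq_div_pos (lam ν t * r)
  rw [u₀, mul_rpow (by positivity) (by positivity), ← rpow_mul hL.le, ← rpow_mul hS.le,
    ← rpow_natCast (lam ν t) 2, ← rpow_add hL]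
  norm_num

theorem E₀_eq (ν R : ℝ) :
    E₀ ν R = -(3 / 4) * (ν + 1) *
      ((3 * ν + 5) - 14 * (ν + 1) * (R ^ 2 / 15) + (3 * ν + 1) * (R ^ 2 / 15) ^ 2) *
        (1 + R ^ 2 / 15) ^ (-(7 : ℝ) / 2) := by
  have hS := one_add_sq_div_pos R
  have h15 : (15 : ℝ) ^ ((7 : ℝ) / 2) = 15 ^ 3 * √15 := by
    rw [sqrt_eq_rpow, ← rpow_natCast, ← rpow_add (by norm_num)]
    norm_num
  rw [E₀, show R ^ 2 + 15 = 15 * (1 + R ^ 2 / 15) by ring, mul_rpow (by norm_num) hS.le, h15,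
    neg_div, rpow_neg hS.le]
  have hP : 0 < (1 + R ^ 2 / 15) ^ ((7 : ℝ) / 2) := rpow_pos_of_pos hS _
  generalize (1 + R ^ 2 / 15) ^ ((7 : ℝ) / 2) = P at hP ⊢
  field_simp
  ring

/-- The first error of the blow-up ansatz: with `p = 7/3` and the radial d'Alembertian
`□ = ∂ₜₜ - ∂ᵣᵣ - (4/r)∂ᵣ` on `ℝ⁵`, one has `t²(u₀^p - □u₀) = λ^(3/2) E₀(λr)`
for all `r, t > 0`. -/
theorem first_error_formula (ν : ℝ) :
    ∀ r > (0 : ℝ), ∀ t > (0 : ℝ),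
      t ^ 2 * (u₀ ν r t ^ ((7 : ℝ) / 3)
        - deriv (fun s => deriv (fun s' => u₀ ν r s') s) t
        + deriv (fun ρ => deriv (fun ρ' => u₀ ν ρ' t) ρ) r
        + (4 / r) * deriv (fun ρ => u₀ ν ρ t) r)
      = lam ν t ^ ((3 : ℝ) / 2) * E₀ ν (lam ν t * r) := by
  intro r hr t ht
  rw [u₀_rpow ν r ht, deriv_deriv_u₀_time ν r ht, deriv_deriv_u₀_radial, deriv_u₀_radial, E₀_eq]
  have hS := one_add_sq_div_pos (lam ν t * r)
  have h5 : (1 + (lam ν t * r) ^ 2 / 15) ^ (-(5 : ℝ) / 2) =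
      (1 + (lam ν t * r) ^ 2 / 15) ^ (-(7 : ℝ) / 2) * (1 + (lam ν t * r) ^ 2 / 15) := by
    rw [← rpow_add_one hS.ne']
    norm_num
  have h3 : (1 + (lam ν t * r) ^ 2 / 15) ^ (-(3 : ℝ) / 2) =
      (1 + (lam ν t * r) ^ 2 / 15) ^ (-(7 : ℝ) / 2) * (1 + (lam ν t * r) ^ 2 / 15) ^ 2 := by
    rw [← rpow_add_natCast hS.ne']
    norm_num
  rw [h3, h5]
  generalize (1 + (lam ν t * r) ^ 2 / 15) ^ (-(7 : ℝ) / 2) = Q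
  generalize lam ν t ^ ((3 : ℝ) / 2) = A
  field_simp
  ring
end

section
/- Let ν > 3 be real, and let V₁ : (0,∞) → ℝ be the explicit function V₁(R) = √15(ν+1)·[ −360(R²−15)R⁵ − 50400 ν (R²−15) R³ log((R²+15)/15) − 75ν(13R⁶ − 1397R⁴ + 6195R² + 4725)R + 7√15 ν (R⁸ + 300R⁶ − 20250R⁴ + 67500R² + 50625) arctan(R/√15) ] / (64 R³ (R²+15)^{5/2}). Then V₁ is twice differentiable on (0,∞) and satisfies, for every R > 0, the linearized elliptic equation −V₁''(R) − (4/R)V₁'(R) − (525/(R²+15)²)·V₁(R) = E₀(R), where E₀(R) = −45√15(ν+1)·(225(3ν+5) + (3ν+1)R⁴ − 210(ν+1)R²)/(4(R²+15)^{7/2}). -/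
open Real

/-- The numerator of `V₁`, up to the constant factor `√15 (ν + 1)`. -/
noncomputable def numerV₁ (ν R : ℝ) : ℝ :=
  -360 * (R ^ 2 - 15) * R ^ 5
    - 50400 * ν * (R ^ 2 - 15) * R ^ 3 * log ((R ^ 2 + 15) / 15)
    - 75 * ν * (13 * R ^ 6 - 1397 * R ^ 4 + 6195 * R ^ 2 + 4725) * R
    + 7 * ν * (R ^ 8 + 300 * R ^ 6 - 20250 * R ^ 4 + 67500 * R ^ 2 + 50625) *
      (√15 * arctan (R / √15))

/-- The derivative of `numerV₁`. -/
noncomputable def derivNumerV₁ (ν R : ℝ) : ℝ :=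
  -360 * (7 * R ^ 6 - 75 * R ^ 4)
    - 50400 * ν * (5 * R ^ 4 - 45 * R ^ 2) * log ((R ^ 2 + 15) / 15)
    - 100800 * ν * (R ^ 6 - 15 * R ^ 4) / (R ^ 2 + 15)
    - 75 * ν * (91 * R ^ 6 - 6985 * R ^ 4 + 18585 * R ^ 2 + 4725)
    + 7 * ν * (8 * R ^ 7 + 1800 * R ^ 5 - 81000 * R ^ 3 + 135000 * R) *
      (√15 * arctan (R / √15))
    + 105 * ν * (R ^ 8 + 300 * R ^ 6 - 20250 * R ^ 4 + 67500 * R ^ 2 + 50625) / (R ^ 2 + 15)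

/-- The second derivative of `numerV₁`. -/
noncomputable def derivDerivNumerV₁ (ν R : ℝ) : ℝ :=
  -360 * (42 * R ^ 5 - 300 * R ^ 3)
    - 50400 * ν * (20 * R ^ 3 - 90 * R) * log ((R ^ 2 + 15) / 15)
    - 100800 * ν * (5 * R ^ 5 - 45 * R ^ 3) / (R ^ 2 + 15)
    - 100800 * ν * ((6 * R ^ 5 - 60 * R ^ 3) * (R ^ 2 + 15) - (R ^ 6 - 15 * R ^ 4) * (2 * R)) /
      (R ^ 2 + 15) ^ 2
    - 75 * ν * (546 * R ^ 5 - 27940 * R ^ 3 + 37170 * R)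
    + 7 * ν * (56 * R ^ 6 + 9000 * R ^ 4 - 243000 * R ^ 2 + 135000) * (√15 * arctan (R / √15))
    + 105 * ν * (8 * R ^ 7 + 1800 * R ^ 5 - 81000 * R ^ 3 + 135000 * R) / (R ^ 2 + 15)
    + 105 * ν * ((8 * R ^ 7 + 1800 * R ^ 5 - 81000 * R ^ 3 + 135000 * R) * (R ^ 2 + 15) -
        (R ^ 8 + 300 * R ^ 6 - 20250 * R ^ 4 + 67500 * R ^ 2 + 50625) * (2 * R)) /
      (R ^ 2 + 15) ^ 2

lemma hasDerivAt_sq_add (c R : ℝ) : HasDerivAt (fun x : ℝ => x ^ 2 + c) (2 * R) R := by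
  simpa using (hasDerivAt_pow 2 R).add_const c

lemma hasDerivAt_log_sq_add_div {c : ℝ} (hc : 0 < c) (R : ℝ) :
    HasDerivAt (fun x : ℝ => log ((x ^ 2 + c) / c)) (2 * R / (R ^ 2 + c)) R := by
  have hS : 0 < R ^ 2 + c := by positivity
  convert! ((hasDerivAt_sq_add c R).div_const c).log (div_pos hS hc).ne' using 1
  field_simp

lemma hasDerivAt_sqrt_mul_arctan_div_sqrt {c : ℝ} (hc : 0 < c) (R : ℝ) :
    HasDerivAt (fun x : ℝ => √c * arctan (x / √c)) (c / (R ^ 2 + c)) R := by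
  have hS : 0 < R ^ 2 + c := by positivity
  have hs : 0 < √c := sqrt_pos.2 hc
  convert! (((hasDerivAt_id R).div_const (√c)).arctan).const_mul (√c) using 1
  simp only [id, div_pow, sq_sqrt hc.le]
  field_simp
  ring

lemma hasDerivAt_numerV₁ (ν R : ℝ) : HasDerivAt (numerV₁ ν) (derivNumerV₁ ν R) R := by
  have hp (n : ℕ) := hasDerivAt_pow n R
  have hL := hasDerivAt_log_sq_add_div (c := 15) (by norm_num) R
  have hB := hasDerivAt_sqrt_mul_arctan_div_sqrt (c := 15) (by norm_num) R
  have hS : R ^ 2 + 15 ≠ 0 := by positivity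
  convert! (((((hp 2).sub_const 15).const_mul (-360)).mul (hp 5)).sub
    (((((hp 2).sub_const 15).const_mul (50400 * ν)).mul (hp 3)).mul hL)).sub
    (((((((hp 6).const_mul 13).sub ((hp 4).const_mul 1397)).add
      ((hp 2).const_mul 6195)).add_const 4725).const_mul (75 * ν)).mul (hasDerivAt_id R)) |>.add
    ((((((hp 8).add ((hp 6).const_mul 300)).sub ((hp 4).const_mul 20250)).add
      ((hp 2).const_mul 67500)).add_const 50625).const_mul (7 * ν) |>.mul hB) using 1
  simp only [derivNumerV₁, Pi.add_apply, Pi.sub_apply, Pi.mul_apply, id]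
  field_simp
  push_cast
  ring

lemma hasDerivAt_derivNumerV₁ (ν R : ℝ) :
    HasDerivAt (derivNumerV₁ ν) (derivDerivNumerV₁ ν R) R := by
  have hp (n : ℕ) := hasDerivAt_pow n R
  have hL := hasDerivAt_log_sq_add_div (c := 15) (by norm_num) R
  have hB := hasDerivAt_sqrt_mul_arctan_div_sqrt (c := 15) (by norm_num) R
  have hQ := hasDerivAt_sq_add 15 R
  have hS : R ^ 2 + 15 ≠ 0 := by positivity
  convert! (((((hp 6).const_mul 7).sub ((hp 4).const_mul 75)).const_mul (-360)).sub
    (((((hp 4).const_mul 5).sub ((hp 2).const_mul 45)).const_mul (50400 * ν)).mul hL)).sub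
    ((((hp 6).sub ((hp 4).const_mul 15)).const_mul (100800 * ν)).div hQ hS) |>.sub
    ((((((hp 6).const_mul 91).sub ((hp 4).const_mul 6985)).add
      ((hp 2).const_mul 18585)).add_const 4725).const_mul (75 * ν)) |>.add
    ((((((hp 7).const_mul 8).add ((hp 5).const_mul 1800)).sub ((hp 3).const_mul 81000)).add
      ((hasDerivAt_id R).const_mul 135000)).const_mul (7 * ν) |>.mul hB) |>.add
    ((((((hp 8).add ((hp 6).const_mul 300)).sub ((hp 4).const_mul 20250)).add
      ((hp 2).const_mul 67500)).add_const 50625).const_mul (105 * ν) |>.div hQ hS) using 1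
  simp only [derivDerivNumerV₁, Pi.add_apply, Pi.sub_apply, id]
  field_simp
  push_cast
  ring

/-- The quotient rule for denominators of the form `x ^ n * (x ^ 2 + c) ^ r`. -/
lemma HasDerivAt.div_pow_mul_sq_add_rpow {f : ℝ → ℝ} {f' R c : ℝ} (hf : HasDerivAt f f' R)
    (hc : 0 < c) (hR : R ≠ 0) (n : ℕ) (r : ℝ) :
    HasDerivAt (fun x => f x / (x ^ n * (x ^ 2 + c) ^ r))
      ((f' * (R * (R ^ 2 + c)) - (n * (R ^ 2 + c) + 2 * r * R ^ 2) * f R) /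
        (R ^ (n + 1) * (R ^ 2 + c) ^ (r + 1))) R := by
  have hS : 0 < R ^ 2 + c := by positivity
  have hT : 0 < (R ^ 2 + c) ^ r := rpow_pos_of_pos hS r
  have hn : R * (n * R ^ (n - 1)) = n * R ^ n := by
    rcases n with _ | n
    · simp
    · simp only [Nat.add_sub_cancel]; ring
  have hn' : n * R ^ (n - 1) = n * R ^ n / R := by rw [← hn]; field_simp
  convert! hf.div ((hasDerivAt_pow n R).mul ((hasDerivAt_sq_add c R).rpow_const (p := r)
    (Or.inl hS.ne'))) (mul_ne_zero (pow_ne_zero n hR) hT.ne') using 1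
  simp only [Pi.mul_apply]
  rw [rpow_add_one hS.ne', rpow_sub_one hS.ne', hn']
  field_simp
  ring

lemma V₁_eq (ν R : ℝ) :
    V₁ ν R = √15 * (ν + 1) / 64 * (numerV₁ ν R / (R ^ 3 * (R ^ 2 + 15) ^ (5 / 2 : ℝ))) := by
  rw [V₁, numerV₁, div_mul_div_comm]
  congr 1 <;> ring

lemma hasDerivAt_V₁ (ν : ℝ) {R : ℝ} (hR : R ≠ 0) :
    HasDerivAt (V₁ ν) (√15 * (ν + 1) / 64 *
      ((derivNumerV₁ ν R * (R * (R ^ 2 + 15)) - (8 * R ^ 2 + 45) * numerV₁ ν R) /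
        (R ^ 4 * (R ^ 2 + 15) ^ (7 / 2 : ℝ)))) R := by
  rw [funext (V₁_eq ν)]
  convert! ((hasDerivAt_numerV₁ ν R).div_pow_mul_sq_add_rpow (c := 15) (by norm_num) hR 3
    (5 / 2)).const_mul (√15 * (ν + 1) / 64) using 3
  · push_cast
    ring
  · norm_num

lemma hasDerivAt_deriv_V₁ (ν : ℝ) {R : ℝ} (hR : R ≠ 0) :
    HasDerivAt (deriv (V₁ ν)) (√15 * (ν + 1) / 64 *
      (((derivDerivNumerV₁ ν R * (R * (R ^ 2 + 15)) - 5 * (R ^ 2 + 6) * derivNumerV₁ ν R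
          - 16 * R * numerV₁ ν R) * (R * (R ^ 2 + 15))
        - (11 * R ^ 2 + 60) *
          (derivNumerV₁ ν R * (R * (R ^ 2 + 15)) - (8 * R ^ 2 + 45) * numerV₁ ν R)) /
        (R ^ 5 * (R ^ 2 + 15) ^ (9 / 2 : ℝ)))) R := by
  have hQ := hasDerivAt_sq_add 15 R
  have hM := ((hasDerivAt_derivNumerV₁ ν R).mul ((hasDerivAt_id R).mul hQ)).sub
    ((((hasDerivAt_pow 2 R).const_mul 8).add_const 45).mul (hasDerivAt_numerV₁ ν R))
  have hev : deriv (V₁ ν) =ᶠ[nhds R] fun x => √15 * (ν + 1) / 64 *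
      ((derivNumerV₁ ν x * (x * (x ^ 2 + 15)) - (8 * x ^ 2 + 45) * numerV₁ ν x) /
        (x ^ 4 * (x ^ 2 + 15) ^ (7 / 2 : ℝ))) := by
    filter_upwards [isOpen_ne.mem_nhds hR] with x hx using (hasDerivAt_V₁ ν hx).deriv
  refine HasDerivAt.congr_of_eventuallyEq ?_ hev
  convert! (hM.div_pow_mul_sq_add_rpow (c := 15) (by norm_num) hR 4 (7 / 2)).const_mul
    (√15 * (ν + 1) / 64) using 3
  · simp only [Pi.sub_apply, Pi.mul_apply, id]
    push_cast
    ring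
  · norm_num

/-- `V₁` is twice differentiable on `(0,∞)` and solves the linearized elliptic equation
`-V₁'' - (4/R)V₁' - (525/(R²+15)²)V₁ = E₀(R)` (linearization of the critical wave
equation around the ground state in dimension 5). -/
theorem V₁_solves_linearized_equation (ν : ℝ) (hν : 3 < ν) :
    ∀ R > (0 : ℝ),
      DifferentiableAt ℝ (V₁ ν) R ∧
      DifferentiableAt ℝ (deriv (V₁ ν)) R ∧
      -(deriv (deriv (V₁ ν)) R) - (4 / R) * deriv (V₁ ν) R
        - (525 / (R ^ 2 + 15) ^ 2) * V₁ ν R = E₀ ν R := by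
  intro R hR
  have h1 := hasDerivAt_V₁ ν hR.ne'
  have h2 := hasDerivAt_deriv_V₁ ν hR.ne'
  refine ⟨h1.differentiableAt, h2.differentiableAt, ?_⟩
  have hS : 0 < R ^ 2 + 15 := by positivity
  have h7 : (R ^ 2 + 15) ^ (7 / 2 : ℝ) = (R ^ 2 + 15) ^ (5 / 2 : ℝ) * (R ^ 2 + 15) := by
    rw [← rpow_add_one hS.ne']; norm_num
  have h9 : (R ^ 2 + 15) ^ (9 / 2 : ℝ) = (R ^ 2 + 15) ^ (5 / 2 : ℝ) * (R ^ 2 + 15) ^ 2 := by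
    rw [← rpow_add_natCast hS.ne']; norm_num
  have hT : 0 < (R ^ 2 + 15) ^ (5 / 2 : ℝ) := rpow_pos_of_pos hS _
  rw [h1.deriv, h2.deriv, V₁_eq, E₀, h7, h9, numerV₁, derivNumerV₁, derivDerivNumerV₁]
  generalize √15 * arctan (R / √15) = B
  generalize log ((R ^ 2 + 15) / 15) = L
  generalize (R ^ 2 + 15) ^ (5 / 2 : ℝ) = T at *
  generalize √15 = s
  field_simp
  ring
end

section
/- Let ν > 3 be real and let V₁ : (0,∞) → ℝ be the explicit function V₁(R) = √15(ν+1)·[ −360(R²−15)R⁵ − 50400 ν (R²−15) R³ log((R²+15)/15) − 75ν(13R⁶ − 1397R⁴ + 6195R² + 4725)R + 7√15 ν (R⁸ + 300R⁶ − 20250R⁴ + 67500R² + 50625) arctan(R/√15) ] / (64 R³ (R²+15)^{5/2}). Then there exists a constant C > 0 such that for all R ≥ 2: | V₁(R) − (105/128)πν(1+ν) + (45/8)√15(1+ν)(1+3ν)/R − (55125/256)πν(1+ν)/R² | ≤ C·log(R)/R³. In particular V₁(R) → C₁(ν) = (105/128)πν(1+ν) as R → ∞. -/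
open Real Filter

open Asymptotics

theorem Real.arctan_le_self {t : ℝ} (ht : 0 ≤ t) : arctan t ≤ t := by
  simpa only [tan_arctan] using
    le_tan (arctan_nonneg.2 ht) (arctan_lt_pi_div_two t)

theorem Real.sub_pow_three_le_arctan {t : ℝ} (ht : 0 ≤ t) : t - t ^ 3 ≤ arctan t := by
  have h1 : sin (arctan t) ≤ arctan t := sin_le (arctan_nonneg.2 ht)
  rw [sin_arctan] at h1
  refine le_trans ?_ h1
  have h2 : √(1 + t ^ 2) ≤ 1 + t ^ 2 := sqrt_le_iff.2 ⟨by positivity, by nlinarith [sq_nonneg t, sq_nonneg (t ^ 2)]⟩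
  have h3 : 0 < √(1 + t ^ 2) := by positivity
  rw [le_div_iff₀ h3]
  rcases le_total (1 - t ^ 2) 0 with h | h
  · nlinarith [mul_nonneg (mul_nonneg ht (neg_nonneg.2 h)) h3.le]
  · nlinarith [mul_nonneg ht (mul_nonneg h (sub_nonneg.2 h2)), pow_nonneg ht 5]

theorem Real.abs_one_add_rpow_neg_five_halves_sub_le {u : ℝ} (hu : 0 ≤ u) :
    |(1 + u) ^ (-(5 / 2) : ℝ) - (1 - 5 / 2 * u)| ≤ 25 / 4 * u ^ 2 := by
  have hpos : 0 < 1 + u := by linarith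
  have h_upper : (1 + u) ^ (-(5 / 2) : ℝ) ≤ 1 - 5 / 2 * u + 25 / 4 * u ^ 2 := by
    have h := one_add_mul_self_le_rpow_one_add (by linarith : -1 ≤ u)
      (by norm_num : (1 : ℝ) ≤ 5 / 2)
    rw [rpow_neg hpos.le]
    refine (inv_anti₀ (by positivity) h).trans ?_
    rw [inv_le_iff_one_le_mul₀ (by positivity)]
    nlinarith [pow_nonneg hu 3]
  have h_lower : 1 - 5 / 2 * u ≤ (1 + u) ^ (-(5 / 2) : ℝ) := by
    have hw : (1 + u)⁻¹ = 1 + -(u / (1 + u)) := by field_simp; ring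
    have hw1 : u / (1 + u) ≤ 1 := (div_le_one hpos).2 (by linarith)
    have hw2 : u / (1 + u) ≤ u := div_le_self hu (by linarith)
    have h := one_add_mul_self_le_rpow_one_add (by linarith : -1 ≤ -(u / (1 + u)))
      (by norm_num : (1 : ℝ) ≤ 5 / 2)
    rw [← hw, inv_rpow hpos.le, ← rpow_neg hpos.le] at h
    linarith
  rw [abs_le]
  constructor <;> nlinarith [sq_nonneg u]

theorem Continuous.comp_inv_isBigO_one {p : ℝ → ℝ} (hp : Continuous p) :
    (fun R : ℝ => p R⁻¹) =O[𝓟 (Set.Ici 2)] (fun _ => (1 : ℝ)) := by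
  have h := hp.continuousOn.isBigO_principal (s := Set.Icc 0 1) isCompact_Icc
    (c := (1 : ℝ)) (by simp)
  refine h.comp_tendsto (tendsto_principal_principal.2 fun R (hR : 2 ≤ R) => ?_)
  exact ⟨by positivity, inv_le_one_of_one_le₀ (by linarith)⟩

theorem inv_pow_three_isBigO_log_div :
    (fun R : ℝ => R⁻¹ ^ 3) =O[𝓟 (Set.Ici 2)] (fun R => log R / R ^ 3) := by
  refine isBigO_principal.2 ⟨(log 2)⁻¹, fun R (hR : 2 ≤ R) => ?_⟩
  have h2 : 0 < log 2 := log_pos (by norm_num)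
  have hlog : log 2 ≤ log R := log_le_log (by norm_num) hR
  have hR0 : 0 < R := by linarith
  rw [norm_of_nonneg (by positivity),
    norm_of_nonneg (div_nonneg (h2.le.trans hlog) (by positivity)), inv_pow, ← mul_div_assoc,
    ← one_div, inv_mul_eq_div]
  gcongr
  rwa [one_le_div h2]

theorem log_mul_inv_pow_three_isBigO :
    (fun R : ℝ => log ((R ^ 2 + 15) / 15) * R⁻¹ ^ 3) =O[𝓟 (Set.Ici 2)]
      (fun R => log R / R ^ 3) := by
  refine isBigO_principal.2 ⟨2, fun R (hR : 2 ≤ R) => ?_⟩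
  have hR0 : 0 < R := by linarith
  have h0 : 0 ≤ log ((R ^ 2 + 15) / 15) := log_nonneg (by nlinarith)
  have h1 : log ((R ^ 2 + 15) / 15) ≤ 2 * log R := by
    rw [← log_rpow hR0]
    exact log_le_log (by positivity) (by norm_num; nlinarith)
  rw [norm_of_nonneg (by positivity),
    norm_of_nonneg (div_nonneg (log_nonneg (by linarith)) (by positivity)), inv_pow,
    ← mul_div_assoc, ← div_eq_mul_inv]
  gcongr

theorem arctan_div_sub_isBigO {s : ℝ} (hs : 0 < s) :
    (fun R : ℝ => arctan (R / s) - (π / 2 - s * R⁻¹)) =O[𝓟 (Set.Ici 2)]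
      (fun R => log R / R ^ 3) := by
  refine IsBigO.trans (isBigO_principal.2 ⟨s ^ 3, fun R (hR : 2 ≤ R) => ?_⟩)
    inv_pow_three_isBigO_log_div
  have hR0 : 0 < R := by linarith
  have ht : 0 < s * R⁻¹ := by positivity
  have h : R / s = (s * R⁻¹)⁻¹ := by field_simp
  rw [h, arctan_inv_of_pos ht, norm_of_nonneg (by positivity : 0 ≤ R⁻¹ ^ 3), norm_eq_abs, abs_le,
    ← mul_pow]
  have h1 := arctan_le_self ht.le
  have h2 := sub_pow_three_le_arctan ht.le
  have h3 := pow_pos ht 3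
  constructor <;> linarith

theorem rpow_neg_five_halves_sub_isBigO :
    (fun R : ℝ => (1 + 15 * R⁻¹ ^ 2) ^ (-(5 / 2) : ℝ) - (1 - 75 / 2 * R⁻¹ ^ 2))
      =O[𝓟 (Set.Ici 2)] (fun R => log R / R ^ 3) := by
  refine IsBigO.trans (isBigO_principal.2 ⟨25 / 4 * 15 ^ 2, fun R (hR : 2 ≤ R) => ?_⟩)
    inv_pow_three_isBigO_log_div
  have hx0 : 0 ≤ R⁻¹ := by positivity
  have hx1 : R⁻¹ ≤ 1 := inv_le_one_of_one_le₀ (by linarith)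
  have h := abs_one_add_rpow_neg_five_halves_sub_le (by positivity : 0 ≤ 15 * R⁻¹ ^ 2)
  rw [norm_of_nonneg (by positivity : 0 ≤ R⁻¹ ^ 3), norm_eq_abs]
  have h4 : R⁻¹ ^ 4 ≤ R⁻¹ ^ 3 := pow_le_pow_of_le_one hx0 hx1 (by norm_num)
  calc _ = |(1 + 15 * R⁻¹ ^ 2) ^ (-(5 / 2) : ℝ) - (1 - 5 / 2 * (15 * R⁻¹ ^ 2))| := by ring_nf
    _ ≤ _ := h
    _ ≤ _ := by linarith

theorem V₁_eq_inv (ν : ℝ) {R : ℝ} (hR : 0 < R) :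
    V₁ ν R = √15 * (ν + 1) / 64 *
      (-360 * (1 - 15 * R⁻¹ ^ 2) * R⁻¹
        - 50400 * ν * (1 - 15 * R⁻¹ ^ 2) * (log ((R ^ 2 + 15) / 15) * R⁻¹ ^ 3)
        - 75 * ν * (13 - 1397 * R⁻¹ ^ 2 + 6195 * R⁻¹ ^ 4 + 4725 * R⁻¹ ^ 6) * R⁻¹
        + 7 * √15 * ν *
            (1 + 300 * R⁻¹ ^ 2 - 20250 * R⁻¹ ^ 4 + 67500 * R⁻¹ ^ 6 + 50625 * R⁻¹ ^ 8) *
          arctan (R / √15)) * (1 + 15 * R⁻¹ ^ 2) ^ (-(5 / 2) : ℝ) := by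
  have hpow : (R ^ 2 + 15) ^ ((5 : ℝ) / 2) = R ^ 5 * (1 + 15 * R⁻¹ ^ 2) ^ ((5 : ℝ) / 2) := by
    have h1 : R ^ 2 + 15 = R ^ 2 * (1 + 15 * R⁻¹ ^ 2) := by field_simp
    have h2 : (R ^ 2) ^ ((5 : ℝ) / 2) = R ^ 5 := by
      rw [← rpow_natCast, ← rpow_mul hR.le, ← rpow_natCast]
      norm_num
    rw [h1, mul_rpow (by positivity) (by positivity), h2]
  have hG : (1 + 15 * R⁻¹ ^ 2) ^ ((5 : ℝ) / 2) ≠ 0 := by positivity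
  rw [V₁, hpow, rpow_neg (by positivity)]
  generalize (1 + 15 * R⁻¹ ^ 2) ^ ((5 : ℝ) / 2) = G at hG ⊢
  generalize arctan (R / √15) = A
  generalize log ((R ^ 2 + 15) / 15) = L
  generalize √15 = s
  field_simp

theorem V₁_sub_expansion_isBigO (ν : ℝ) :
    (fun R => V₁ ν R - 105 / 128 * π * ν * (1 + ν)
        + 45 / 8 * √15 * (1 + ν) * (1 + 3 * ν) / R
        - 55125 / 256 * π * ν * (1 + ν) / R ^ 2)
      =O[𝓟 (Set.Ici 2)] (fun R => log R / R ^ 3) := by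
  set s := √15 with hs
  have hs2 : s ^ 2 = 15 := sq_sqrt (by norm_num)
  let k := s * (ν + 1) / 64
  let q : ℝ → ℝ := fun x => 1 + 300 * x ^ 2 - 20250 * x ^ 4 + 67500 * x ^ 6 + 50625 * x ^ 8
  let m : ℝ → ℝ := fun x => 5400 - 75 * ν * (-1397 + 6195 * x ^ 2 + 4725 * x ^ 4)
    + 7 * s * ν * ((-20250 * x + 67500 * x ^ 3 + 50625 * x ^ 5) * (π / 2)
      - s * (300 - 20250 * x ^ 2 + 67500 * x ^ 4 + 50625 * x ^ 6))
  let M : ℝ → ℝ := fun x => 7 * s * ν * π / 2 - (360 + 1080 * ν) * x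
    + 1050 * s * ν * π * x ^ 2 + x ^ 3 * m x
  let W : ℝ → ℝ := fun x => k * (m x * (1 - 75 / 2 * x ^ 2) + 75 / 2 * (360 + 1080 * ν)
    - 75 / 2 * (1050 * s * ν * π) * x)
  have hB := rpow_neg_five_halves_sub_isBigO
  have hG : (fun R : ℝ => (1 + 15 * R⁻¹ ^ 2) ^ (-(5 / 2) : ℝ)) =O[𝓟 (Set.Ici 2)]
      (fun _ => (1 : ℝ)) :=
    Continuous.comp_inv_isBigO_one (p := fun x => (1 + 15 * x ^ 2) ^ (-(5 / 2) : ℝ))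
      (Continuous.rpow_const (by fun_prop) fun x => Or.inl (by positivity))
  have hW := inv_pow_three_isBigO_log_div.mul
    (Continuous.comp_inv_isBigO_one (p := W) (by fun_prop))
  have hM := hB.mul (Continuous.comp_inv_isBigO_one (p := fun x => k * M x) (by fun_prop))
  have hA := ((arctan_div_sub_isBigO (s := s) (by positivity)).mul hG).mul
    (Continuous.comp_inv_isBigO_one (p := fun x => k * (7 * s * ν * q x)) (by fun_prop))
  have hL := (log_mul_inv_pow_three_isBigO.mul hG).mul
    (Continuous.comp_inv_isBigO_one (p := fun x => k * (-50400 * ν * (1 - 15 * x ^ 2)))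
      (by fun_prop))
  simp only [mul_one] at hW hM hA hL
  refine (((hW.add hM).add hA).add hL).congr' ?_ EventuallyEq.rfl
  refine eventually_principal.2 fun R (hR : 2 ≤ R) => ?_
  beta_reduce
  rw [V₁_eq_inv ν (by linarith), ← hs, div_eq_mul_inv _ R, div_eq_mul_inv _ (R ^ 2), ← inv_pow]
  generalize (1 + 15 * R⁻¹ ^ 2) ^ (-(5 / 2) : ℝ) = G
  generalize arctan (R / s) = A
  generalize log ((R ^ 2 + 15) / 15) = L
  generalize R⁻¹ = x
  simp only [W, M, m, q, k]
  linear_combination (7 * ν * x * G * s * (ν + 1) / 64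
    - ν * π * (ν + 1) * (7 / 128 + 3675 / 256 * x ^ 2)) * hs2

/-- Asymptotic expansion of `V₁` at infinity: there is `C > 0` with
`|V₁(R) - C₁(ν) + (45/8)√15(1+ν)(1+3ν)/R - (55125/256)πν(1+ν)/R²| ≤ C log R / R³`
for `R ≥ 2`; in particular `V₁(R) → C₁(ν) = (105/128)πν(1+ν)` as `R → ∞`. -/
theorem V₁_asymptotics (ν : ℝ) (hν : 3 < ν) :
    (∃ C > (0 : ℝ), ∀ R ≥ (2 : ℝ),
      |V₁ ν R - 105 / 128 * π * ν * (1 + ν)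
          + 45 / 8 * Real.sqrt 15 * (1 + ν) * (1 + 3 * ν) / R
          - 55125 / 256 * π * ν * (1 + ν) / R ^ 2|
        ≤ C * Real.log R / R ^ 3) ∧
    Tendsto (V₁ ν) atTop (nhds (105 / 128 * π * ν * (1 + ν))) := by
  have hO := V₁_sub_expansion_isBigO ν
  constructor
  · obtain ⟨C, hC, h⟩ := isBigO_iff'.1 hO
    refine ⟨C, hC, fun R hR => ?_⟩
    have hR' := eventually_principal.1 h R hR
    rwa [norm_eq_abs, norm_of_nonneg
      (div_nonneg (log_nonneg (by linarith)) (pow_nonneg (by linarith) 3)), ← mul_div_assoc] at hR'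
  · have hg : Tendsto (fun R : ℝ => log R / R ^ 3) atTop (nhds 0) := by
      simpa using isLittleO_log_rpow_atTop (r := 3) (by norm_num) |>.tendsto_div_nhds_zero
    have hD := (hO.mono (le_principal_iff.2 (Ici_mem_atTop 2))).trans_tendsto hg
    have h1 : Tendsto (fun R : ℝ => 45 / 8 * √15 * (1 + ν) * (1 + 3 * ν) / R) atTop (nhds 0) :=
      tendsto_const_nhds.div_atTop tendsto_id
    have h2 : Tendsto (fun R : ℝ => 55125 / 256 * π * ν * (1 + ν) / R ^ 2) atTop (nhds 0) :=
      tendsto_const_nhds.div_atTop (tendsto_pow_atTop (by norm_num))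
    have h := ((hD.sub h1).add h2).add_const (105 / 128 * π * ν * (1 + ν))
    simp only [sub_zero, add_zero, zero_add] at h
    exact h.congr fun R => by ring
end
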